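/- For every 2-DRGP stencil H (of size 2n × n), the visible rank of the tensor product H ⊗ H is at least n. -/

import Mathlib

noncomputable section

/-- A square stencil (Bool matrix, `true` = ⋆) is visibly full rank if it has a
unique generalized diagonal of ⋆'s. -/
def VisFullRank {α : Type*} (M : Matrix α α Bool) : Prop :=
  ∃! σ : Equiv.Perm α, ∀ i, M i (σ i) = true

/-- The visible rank of a stencil: the largest `k` admitting a `k × k`
visibly full rank sub-stencil. -/
def vrk {α β : Type*} (H : Matrix α β Bool) : ℕ :=
  sSup {k : ℕ | ∃ r : Fin k → α, ∃ c : Fin k → β,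
    Function.Injective r ∧ Function.Injective c ∧
    VisFullRank (Matrix.of fun i j => H (r i) (c j))}

/-- Tensor product of stencils. -/
def stTensor {α₁ β₁ α₂ β₂ : Type*} (H₁ : Matrix α₁ β₁ Bool) (H₂ : Matrix α₂ β₂ Bool) :
    Matrix (α₁ × α₂) (β₁ × β₂) Bool :=
  Matrix.of fun a b => H₁ a.1 b.1 && H₂ a.2 b.2

/-- `k`-th tensor power of a stencil. -/
def stPow {α β : Type*} (H : Matrix α β Bool) (k : ℕ) :
    Matrix (Fin k → α) (Fin k → β) Bool :=
  Matrix.of fun r c => decide (∀ i, H (r i) (c i) = true)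

/-- `W` is an `F`-witness of the stencil `H`. -/
def IsWitness {α β F : Type*} [Field F] (H : Matrix α β Bool) (W : Matrix α β F) : Prop :=
  ∀ i j, W i j ≠ 0 ↔ H i j = true

/-- The `F`-rank of a stencil: the minimum rank of an `F`-witness. -/
def frk (F : Type*) [Field F] {α β : Type*} [Fintype β] (H : Matrix α β Bool) : ℕ :=
  sInf {r : ℕ | ∃ W : Matrix α β F, IsWitness H W ∧ W.rank = r}

/-- For every 2-DRGP stencil `H` (of size `2n × n`), `vrk (H ⊗ H) ≥ n`. -/
theorem stmt0 (n : ℕ) (H : Matrix (Fin n × Fin 2) (Fin n) Bool)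
    (hdiag : ∀ (i : Fin n) (j : Fin 2), H (i, j) i = true)
    (hdisj : ∀ (i k : Fin n), k ≠ i →
      ∀ j j' : Fin 2, H (i, j) k = true → H (i, j') k = true → j = j') :
    n ≤ vrk (stTensor H H) := by
  apply le_csSup
  · refine ⟨Fintype.card ((Fin n × Fin 2) × (Fin n × Fin 2)), ?_⟩
    rintro k ⟨r, -, hr, -⟩
    simpa using Fintype.card_le_of_injective r hr
  · refine ⟨fun i => ((i, 0), (i, 1)), fun i => (i, i), fun i j h => ?_, fun i j h => ?_, 1, ?_, ?_⟩
    · exact congrArg (fun p => p.1.1) h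
    · exact congrArg Prod.fst h
    · intro i
      simp [stTensor, hdiag]
    · intro σ hσ
      ext1 i
      by_contra hne
      have h : H (i, 0) (σ i) = true ∧ H (i, 1) (σ i) = true := by
        simpa [stTensor] using hσ i
      exact zero_ne_one (hdisj i (σ i) hne 0 1 h.1 h.2)
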